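/- arXiv:cs/0105013 — 5 statements merged into one kernel-verified Lean document; each statement's English description precedes it below -/
import Mathlib

section
/- In Dijkstra's token-ring protocol on a ring of 5 processors with 3 labels, every configuration in which all three labels are present has at least two enabled processors (in fact, at least two of the processors p2,...,p5 are enabled); in particular such a configuration is not legitimate. Formally: if x : Fin 5 → ZMod 3 is surjective, then there exist i j : Fin 5 with i ≠ j, i ≠ 0, j ≠ 0, x i ≠ x (i-1) and x j ≠ x (j-1). -/
/-- Dijkstra's token-ring protocol on 5 processors with 3 labels:
processor `i ≠ 0` is enabled iff its label differs from its left neighbor's;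
a configuration with all three labels present has at least two enabled
processors among `p2,...,p5`, hence is not legitimate. -/
theorem dijkstra_all_labels_present_two_enabled
    (x : Fin 5 → ZMod 3) (hx : Function.Surjective x) :
    ∃ i j : Fin 5, i ≠ j ∧ i ≠ 0 ∧ j ≠ 0 ∧ x i ≠ x (i - 1) ∧ x j ≠ x (j - 1) := by
  by_contra! h
  have h_ends : ∀ k, x k = x 0 ∨ x k = x 4 := by
    have h12 : x 1 ≠ x 0 → x 2 = x 1 := h 1 2 (by decide) (by decide) (by decide)
    have h13 : x 1 ≠ x 0 → x 3 = x 2 := h 1 3 (by decide) (by decide) (by decide)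
    have h14 : x 1 ≠ x 0 → x 4 = x 3 := h 1 4 (by decide) (by decide) (by decide)
    have h23 : x 2 ≠ x 1 → x 3 = x 2 := h 2 3 (by decide) (by decide) (by decide)
    have h24 : x 2 ≠ x 1 → x 4 = x 3 := h 2 4 (by decide) (by decide) (by decide)
    have h34 : x 3 ≠ x 2 → x 4 = x 3 := h 3 4 (by decide) (by decide) (by decide)
    rw [Fin.forall_fin_succ, Fin.forall_fin_succ, Fin.forall_fin_succ, Fin.forall_fin_two]
    change (x 0 = x 0 ∨ _) ∧ (x 1 = x 0 ∨ x 1 = _) ∧ (x 2 = x 0 ∨ x 2 = _) ∧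
      (x 3 = x 0 ∨ x 3 = _) ∧ (x 4 = x 0 ∨ x 4 = _)
    by_cases h1 : x 1 = x 0 <;> by_cases h2 : x 2 = x 1 <;> by_cases h3 : x 3 = x 2 <;>
      clear h hx <;> grind
  have h_univ : (Finset.univ : Finset (ZMod 3)) ⊆ {x 0, x 4} := by
    intro c _
    obtain ⟨k, rfl⟩ := hx c
    simpa using h_ends k
  have h_card := (Finset.card_le_card h_univ).trans Finset.card_le_two
  rw [Finset.card_univ, ZMod.card] at h_card
  omega
end

section
/- Dijkstra's token-ring protocol on a ring of n = 5 processors with n - 2 = 3 labels does not self-stabilize under a fair central daemon: there exist a sequence of configurations f : ℕ → (Fin 5 → ZMod 3) and a schedule σ : ℕ → Fin 5 such that f 0 = (0,0,2,1,0), for every t the processor σ t is enabled in f t and f (t+1) results from f t by the move of processor σ t, every processor index occurs infinitely often in σ, and for every t the configuration f t is surjective onto ZMod 3 (all three labels are present); in particular no f t is legitimate. -/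
/-- Processor `0` (the top machine `p1`) is enabled iff `x 0 = x 4`;
processor `i ≠ 0` is enabled iff `x i ≠ x (i-1)`. -/
def enabledD (x : Fin 5 → ZMod 3) (i : Fin 5) : Prop :=
  if i = 0 then x 0 = x 4 else x i ≠ x (i - 1)

/-- The move of processor `i`: the top machine increments its label (mod 3),
any other machine copies the label of its left neighbor. -/
def moveD (x : Fin 5 → ZMod 3) (i : Fin 5) : Fin 5 → ZMod 3 :=
  Function.update x i (if i = 0 then x 0 + 1 else x (i - 1))

/-- A configuration is legitimate iff exactly one processor is enabled. -/
def legitimateD (x : Fin 5 → ZMod 3) : Prop :=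
  ∃! i : Fin 5, enabledD x i

instance (x : Fin 5 → ZMod 3) : DecidablePred (enabledD x) := fun i => by
  unfold enabledD; infer_instance

instance : DecidablePred legitimateD := fun x =>
  inferInstanceAs (Decidable (∃ i, enabledD x i ∧ ∀ j, enabledD x j → j = i))

/-- A closed orbit of length `15` of the protocol: each label increases by `1` once every
five steps. -/
def periodicConfig (j : ZMod 15) (i : Fin 5) : ZMod 3 :=
  (![0, 0, 2, 1, 0] : Fin 5 → ZMod 3) i + ((j.val + (i + 4).val) / 5 : ℕ)

/-- The schedule `0, 4, 3, 2, 1` of the closed orbit, repeated three times. -/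
def periodicSchedule (j : ZMod 15) : Fin 5 :=
  Fin.ofNat 5 (4 * j.val)

theorem periodicConfig_zero : periodicConfig 0 = ![0, 0, 2, 1, 0] := by
  decide

theorem enabledD_periodicConfig :
    ∀ j, enabledD (periodicConfig j) (periodicSchedule j) := by
  decide

theorem periodicConfig_add_one :
    ∀ j, periodicConfig (j + 1) = moveD (periodicConfig j) (periodicSchedule j) := by
  decide

theorem periodicSchedule_surjective : Function.Surjective periodicSchedule := by
  unfold Function.Surjective
  decide

theorem periodicConfig_surjective : ∀ j, Function.Surjective (periodicConfig j) := by
  unfold Function.Surjective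
  decide

theorem not_legitimateD_periodicConfig : ∀ j, ¬ legitimateD (periodicConfig j) := by
  decide

/-- Dijkstra's protocol on a ring of `n = 5` processors with `n - 2 = 3`
labels does not self-stabilize under a fair central daemon: there is an
execution starting from `(0,0,2,1,0)` in which every processor is activated
infinitely often, every activated processor is enabled and performs its move,
yet every configuration reached contains all three labels — in particular no
configuration of the execution is legitimate. -/
theorem dijkstra_not_selfStabilizing_five_procs_three_labels :
    ∃ (f : ℕ → (Fin 5 → ZMod 3)) (σ : ℕ → Fin 5),
      f 0 = ![0,0,2,1,0] ∧
      (∀ t : ℕ, enabledD (f t) (σ t) ∧ f (t + 1) = moveD (f t) (σ t)) ∧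
      (∀ i : Fin 5, ∀ T : ℕ, ∃ t, T ≤ t ∧ σ t = i) ∧
      (∀ t : ℕ, Function.Surjective (f t)) ∧
      (∀ t : ℕ, ¬ legitimateD (f t)) := by
  refine ⟨fun t => periodicConfig t, fun t => periodicSchedule t, ?_, fun t => ⟨?_, ?_⟩,
    fun i T => ?_, fun t => periodicConfig_surjective t,
    fun t => not_legitimateD_periodicConfig t⟩
  · simpa using periodicConfig_zero
  · exact enabledD_periodicConfig t
  · simpa using periodicConfig_add_one t
  · obtain ⟨j, rfl⟩ := periodicSchedule_surjective i
    refine ⟨15 * T + j.val, by omega, congrArg periodicSchedule ?_⟩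
    rw [Nat.cast_add, Nat.cast_mul, ZMod.natCast_self, zero_mul, zero_add, ZMod.natCast_zmod_val]
end

section
/- Atomic transfer of Gray-coded counters with a parity bit: let m ≥ 1 and let g g' : Fin m → ZMod 2 satisfy hammingDist g g' = 1. Define old, new : Fin (m+1) → ZMod 2 by appending the parity bit: old = Fin.snoc g (∑ i, g i) and new = Fin.snoc g' (∑ i, g' i). If v : Fin (m+1) → ZMod 2 satisfies v i ∈ {old i, new i} for every i (each bit read returns the old or the new value), and v passes the parity check v (Fin.last m) = ∑ i : Fin m, v (i.castSucc), then v = old or v = new. -/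
/-- If two words differ in exactly one coordinate, every coordinatewise mixture of them is
one of the two. -/
theorem eq_or_eq_of_hammingDist_eq_one {ι : Type*} [Fintype ι] {β : ι → Type*}
    [∀ i, DecidableEq (β i)] {x y z : ∀ i, β i} (hxy : hammingDist x y = 1)
    (hz : ∀ i, z i = x i ∨ z i = y i) : z = x ∨ z = y := by
  obtain ⟨j, hj⟩ := Finset.card_eq_one.mp hxy
  have agree : ∀ i, i ≠ j → x i = y i := by
    intro i hi
    by_contra hne
    have hmem : i ∈ ({j} : Finset ι) := hj ▸ Finset.mem_filter.mpr ⟨Finset.mem_univ i, hne⟩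
    exact hi (Finset.mem_singleton.mp hmem)
  refine (hz j).imp (fun h => ?_) (fun h => ?_) <;> funext i <;> by_cases hi : i = j
  · exact hi ▸ h
  · exact (hz i).elim id fun h' => h'.trans (agree i hi).symm
  · exact hi ▸ h
  · exact (hz i).elim (fun h' => h'.trans (agree i hi)) id

/-- A word passing the parity check is its initial part followed by the parity bit. -/
theorem eq_snoc_sum_of_init_eq {M : Type*} [AddCommMonoid M] {m : ℕ} {v : Fin (m + 1) → M}
    {g : Fin m → M} (hparity : v (Fin.last m) = ∑ i : Fin m, v i.castSucc)
    (hg : (fun i : Fin m => v i.castSucc) = g) :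
    v = Fin.snoc (α := fun _ => M) g (∑ i, g i) := by
  subst hg
  rw [← hparity]
  exact (Fin.snoc_init_self v).symm

/-- Atomic transfer of Gray-coded counters with a parity bit: let the old
and new register contents consist of Gray codes `g, g'` differing in exactly
one bit, each followed by its parity bit.  If every bit of a read `v` equals
the corresponding old or new bit, and `v` passes the parity check, then `v`
is exactly the old or the new register contents. -/
theorem graycode_parity_safe_register_atomic_transfer
    {m : ℕ} (hm : 1 ≤ m) (g g' : Fin m → ZMod 2)
    (hgg : hammingDist g g' = 1)
    (oldw neww : Fin (m + 1) → ZMod 2)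
    (hold : oldw = Fin.snoc g (∑ i : Fin m, g i))
    (hnew : neww = Fin.snoc g' (∑ i : Fin m, g' i))
    (v : Fin (m + 1) → ZMod 2)
    (hv : ∀ i : Fin (m + 1), v i = oldw i ∨ v i = neww i)
    (hparity : v (Fin.last m) = ∑ i : Fin m, v i.castSucc) :
    v = oldw ∨ v = neww := by
  subst hold hnew
  have hinit : ∀ i : Fin m, v i.castSucc = g i ∨ v i.castSucc = g' i := fun i => by
    simpa only [Fin.snoc_castSucc] using hv i.castSucc
  exact (eq_or_eq_of_hammingDist_eq_one hgg hinit).imp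
    (eq_snoc_sum_of_init_eq hparity) (eq_snoc_sum_of_init_eq hparity)
end

section
/- Consecutive Gray codewords differ in exactly one bit position: for every natural number n there is exactly one index i such that Nat.testBit (gray n) i ≠ Nat.testBit (gray (n+1)) i, where gray n = n ^^^ (n >>> 1). -/
/-- Removing the last bit commutes with taking the Gray code, read off bitwise. -/
theorem testBit_xor_shiftRight_one_succ (n i : ℕ) :
    Nat.testBit (n ^^^ (n >>> 1)) (i + 1) = Nat.testBit (n / 2 ^^^ ((n / 2) >>> 1)) i := by
  simp only [Nat.testBit_xor, Nat.shiftRight_one, Nat.testBit_div_two]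

theorem testBit_xor_shiftRight_one_zero (n : ℕ) :
    Nat.testBit (n ^^^ (n >>> 1)) 0 = (decide (n % 2 = 1) ^^ decide (n / 2 % 2 = 1)) := by
  rw [Nat.testBit_xor, Nat.testBit_zero, Nat.testBit_zero, Nat.shiftRight_one]

/-- Consecutive Gray codewords differ in exactly one bit position, where
`gray n = n ^^^ (n >>> 1)`. -/
theorem gray_succ_differs_in_exactly_one_bit (n : ℕ) :
    ∃! i : ℕ, Nat.testBit (n ^^^ (n >>> 1)) i ≠
      Nat.testBit ((n + 1) ^^^ ((n + 1) >>> 1)) i := by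
  induction n using Nat.strong_induction_on with
  | _ n ih =>
    rcases Nat.mod_two_eq_zero_or_one n with h | h
    · have hd : (n + 1) / 2 = n / 2 := by omega
      refine ⟨0, ?_, fun i hi => ?_⟩
      · have hm : (n + 1) % 2 = 1 := by omega
        simp only [testBit_xor_shiftRight_one_zero, h, hm, hd]
        simp
      · cases i with
        | zero => rfl
        | succ i => simp only [testBit_xor_shiftRight_one_succ, hd, ne_eq, not_true] at hi
    · have hd : (n + 1) / 2 = n / 2 + 1 := by omega
      obtain ⟨j, hj, hu⟩ := ih (n / 2) (by omega)
      refine ⟨j + 1, ?_, fun i hi => ?_⟩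
      · simpa only [testBit_xor_shiftRight_one_succ, hd] using hj
      · cases i with
        | zero =>
          have hm : (n + 1) % 2 = 0 := by omega
          simp only [testBit_xor_shiftRight_one_zero, h, hm, hd] at hi
          rcases Nat.mod_two_eq_zero_or_one (n / 2) with h' | h' <;>
            simp [Nat.add_mod, h'] at hi
        | succ i =>
          simp only [testBit_xor_shiftRight_one_succ, hd] at hi
          rw [hu i hi]
end

section
/- The Gray code map is injective: for all natural numbers n and l, if n ^^^ (n >>> 1) = l ^^^ (l >>> 1) then n = l. Hence a Gray codeword uniquely determines the counter value it encodes. -/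
/-- The Gray code map `n ↦ n ^^^ (n >>> 1)` is injective: a Gray codeword
uniquely determines the counter value it encodes. -/
theorem gray_injective (n l : ℕ) (h : n ^^^ (n >>> 1) = l ^^^ (l >>> 1)) :
    n = l := by
  induction n using Nat.strong_induction_on generalizing l with
  | _ n ih =>
    rcases Nat.eq_zero_or_pos n with rfl | hn
    · have hl : l = l >>> 1 := by
        rw [← Nat.xor_eq_zero_iff, ← h]
        rfl
      rw [Nat.shiftRight_one] at hl
      omega
    · have half : n >>> 1 = l >>> 1 := by
        refine ih (n >>> 1) (by rw [Nat.shiftRight_one]; omega) (l >>> 1) ?_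
        rw [← Nat.shiftRight_xor_distrib, ← Nat.shiftRight_xor_distrib, h]
      rw [half] at h
      exact Nat.xor_left_injective h
end
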